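/- arXiv:2512.17258 — 3 statements merged into one kernel-verified Lean document; each statement's English description precedes it below -/
import Mathlib

section
/- Let G = (V₁,E₁) be a connected graph with |V₁| ≥ 2 and H = (V₂,E₂) an arbitrary graph with |V₂| ≥ 1. Then QEC(G⊙H) ≥ max{ −2 + √2, QEC(G), QEC(K₁+H) }. -/
open scoped BigOperators
open Filter Topology
open scoped Classical

namespace QECPaper

/-- The cone (join) `K₁ + H` over a graph `H`: vertex `none` is the apex. -/
def cone {V₂ : Type*} (H : SimpleGraph V₂) : SimpleGraph (Option V₂) where
  Adj x y := (∃ a b, x = some a ∧ y = some b ∧ H.Adj a b) ∨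
    (x = none ∧ y ≠ none) ∨ (x ≠ none ∧ y = none)
  symm := by
    constructor
    rintro x y (⟨a, b, rfl, rfl, h⟩ | ⟨rfl, hy⟩ | ⟨hx, rfl⟩)
    · exact Or.inl ⟨b, a, rfl, rfl, h.symm⟩
    · exact Or.inr (Or.inr ⟨hy, rfl⟩)
    · exact Or.inr (Or.inl ⟨rfl, hx⟩)
  loopless := by
    constructor
    rintro x (⟨a, b, rfl, hb, h⟩ | ⟨rfl, hy⟩ | ⟨hx, rfl⟩)
    · exact H.loopless.irrefl a (by cases hb; exact h)
    · exact hy rfl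
    · exact hx rfl

/-- The corona `G ⊙ H` of two graphs, realized on `V₁ × ({o} ∪ V₂)`
with `o = none`. -/
def corona {V₁ V₂ : Type*} (G : SimpleGraph V₁) (H : SimpleGraph V₂) :
    SimpleGraph (V₁ × Option V₂) where
  Adj p q := (p.1 = q.1 ∧ (cone H).Adj p.2 q.2) ∨
    (G.Adj p.1 q.1 ∧ p.2 = none ∧ q.2 = none)
  symm := by
    constructor
    rintro ⟨i, x⟩ ⟨j, y⟩ (⟨h1, h2⟩ | ⟨h1, h2, h3⟩)
    · exact Or.inl ⟨h1.symm, (cone H).symm.symm _ _ h2⟩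
    · exact Or.inr ⟨h1.symm, h3, h2⟩
  loopless := by
    constructor
    rintro ⟨i, x⟩ (⟨h1, h2⟩ | ⟨h1, h2, h3⟩)
    · exact (cone H).loopless.irrefl x h2
    · exact G.loopless.irrefl i h1

/-- The quadratic embedding constant of a (connected) graph on a finite vertex set. -/
noncomputable def QEC {V : Type*} [Fintype V] (G : SimpleGraph V) : ℝ :=
  sSup {r : ℝ | ∃ f : V → ℝ, (∑ x, f x ^ 2) = 1 ∧ (∑ x, f x) = 0 ∧
    r = ∑ x, ∑ y, f x * (G.dist x y : ℝ) * f y}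

/-- The set `λ(S)` of `λ` appearing in a solution of the basic equations. -/
def lambdaS {V : Type*} [Fintype V] (G : SimpleGraph V) : Set ℝ :=
  {lam : ℝ | ∃ (f : V → ℝ) (μ : ℝ),
    (∀ x, (∑ y, (G.dist x y : ℝ) * f y) - lam * f x = μ / 2) ∧
    (∑ x, f x) = 0 ∧ (∑ x, f x ^ 2) = 1}

/-- The distance matrix of a graph, with real entries. -/
noncomputable def distMatrix {V : Type*} (G : SimpleGraph V) : Matrix V V ℝ :=
  Matrix.of fun x y => (G.dist x y : ℝ)

section MatrixFunctions

variable {ι : Type*} [Fintype ι] [DecidableEq ι]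

/-- The eigenspace `ker (A - α)` inside `EuclideanSpace ℝ ι`. -/
noncomputable def eigSpace (A : Matrix ι ι ℝ) (α : ℝ) :
    Submodule ℝ (EuclideanSpace ℝ ι) :=
  LinearMap.ker (Matrix.toEuclideanLin A - α • LinearMap.id)

/-- The all-ones vector of `EuclideanSpace ℝ ι`. -/
noncomputable def onesE (ι : Type*) [Fintype ι] : EuclideanSpace ℝ ι :=
  (WithLp.equiv 2 (ι → ℝ)).symm (fun _ => 1)

/-- `‖E_α 𝟏‖²`, where `E_α` is the orthogonal projection of `EuclideanSpace ℝ ι`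
onto the eigenspace `ker (A - α)`. -/
noncomputable def projNormSq (A : Matrix ι ι ℝ) (α : ℝ) : ℝ :=
  ‖(Submodule.orthogonalProjectionOnto (eigSpace A α) (onesE ι) : EuclideanSpace ℝ ι)‖ ^ 2

/-- The set of (real) eigenvalues of a matrix. -/
def evSet (A : Matrix ι ι ℝ) : Set ℝ :=
  {α : ℝ | ∃ v : ι → ℝ, v ≠ 0 ∧ A.mulVec v = α • v}

/-- The set of main eigenvalues: those `α` with `E_α 𝟏 ≠ 0`. -/
def mainEv (A : Matrix ι ι ℝ) : Set ℝ := {α : ℝ | projNormSq A α ≠ 0}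

/-- `k_A = |ev_M(A) \ {-2}|`. -/
noncomputable def kA (A : Matrix ι ι ℝ) : ℕ := (mainEv A \ {(-2 : ℝ)}).ncard

/-- The ω-function associated with the symmetric matrix `A`. -/
noncomputable def omegaFun (A : Matrix ι ι ℝ) (lam : ℝ) : ℝ :=
  1 + projNormSq A (-2) +
    ∑ᶠ α ∈ mainEv A \ {(-2 : ℝ)}, lam / (α + 2 + lam) * projNormSq A α

/-- The (maximal) domain of the ω-function: the complement of its poles. -/
def omegaDomain (A : Matrix ι ι ℝ) : Set ℝ :=
  {lam : ℝ | ∀ α ∈ mainEv A \ {(-2 : ℝ)}, lam ≠ -α - 2}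

/-- The set of zeroes of the ω-function (on its domain). -/
def omegaZeros (A : Matrix ι ι ℝ) : Set ℝ :=
  {lam : ℝ | lam ∈ omegaDomain A ∧ omegaFun A lam = 0}

/-- `λ*`, the largest zero of the ω-function. -/
noncomputable def lamStar (A : Matrix ι ι ℝ) : ℝ := sSup (omegaZeros A)

/-- The ψ-function associated with `A`: `ψ_A(λ) = λ/ω_A(λ)` extended
analytically across the poles of `ω_A` by the value `0`. -/
noncomputable def psiFun (A : Matrix ι ι ℝ) (lam : ℝ) : ℝ :=
  if -lam - 2 ∈ mainEv A \ {(-2 : ℝ)} then 0 else lam / omegaFun A lam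

/-- The inverse of the rightmost branch `ψ_{A*} = ψ_A ↾ (λ*, +∞)`:
`ψ_{A*}⁻¹(y)` is the unique `λ > λ*` with `ψ_A(λ) = y`. -/
noncomputable def psiStarInv (A : Matrix ι ι ℝ) (y : ℝ) : ℝ :=
  sSup {lam : ℝ | lamStar A < lam ∧ psiFun A lam = y}

end MatrixFunctions

/-- Distances do not increase along a map sending edges to edges or to single vertices. -/
theorem dist_map_le {V W : Type*} {G : SimpleGraph V} {K : SimpleGraph W} (r : V → W)
    (hr : ∀ x y, G.Adj x y → r x = r y ∨ K.Adj (r x) (r y)) {x y : V} (h : G.Reachable x y) :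
    K.dist (r x) (r y) ≤ G.dist x y := by
  have key : ∀ {x y : V} (w : G.Walk x y),
      ∃ w' : K.Walk (r x) (r y), w'.length ≤ w.length := by
    intro x y w
    induction w with
    | nil => exact ⟨.nil, le_rfl⟩
    | cons hadj _ ih =>
      obtain ⟨w', hw'⟩ := ih
      rcases hr _ _ hadj with he | ha
      · exact ⟨w'.copy he.symm rfl, by simp; omega⟩
      · exact ⟨.cons ha w', by simpa using hw'⟩
  obtain ⟨w, hw⟩ := h.exists_walk_length_eq_dist
  obtain ⟨w', hw'⟩ := key w
  exact (SimpleGraph.dist_le w').trans (hw'.trans hw.le)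

/-- A function growing by at most one along each edge is `1`-Lipschitz. -/
theorem le_add_dist {V : Type*} {G : SimpleGraph V} (ht : V → ℕ)
    (hr : ∀ x y, G.Adj x y → ht x ≤ ht y + 1) {x y : V} (h : G.Reachable x y) :
    ht x ≤ ht y + G.dist x y := by
  have key : ∀ {x y : V} (w : G.Walk x y), ht x ≤ ht y + w.length := by
    intro x y w
    induction w with
    | nil => simp
    | cons hadj _ ih =>
      have := hr _ _ hadj
      simp only [SimpleGraph.Walk.length_cons]
      omega
  obtain ⟨w, hw⟩ := h.exists_walk_length_eq_dist
  exact hw ▸ key w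

/-- An injective homomorphism with a retraction sending edges to edges or vertices
preserves distances. -/
theorem dist_eq_of_retraction {V W : Type*} {G : SimpleGraph V} {K : SimpleGraph W}
    (hG : G.Connected) (φ : G →g K) (r : W → V) (hrφ : ∀ v, r (φ v) = v)
    (hr : ∀ x y, K.Adj x y → r x = r y ∨ G.Adj (r x) (r y)) (x y : V) :
    K.dist (φ x) (φ y) = G.dist x y := by
  apply le_antisymm
  · exact dist_map_le φ (fun _ _ h => Or.inr (φ.map_adj h)) (hG.preconnected x y)
  · simpa only [hrφ] using dist_map_le r hr ((hG.preconnected x y).map φ)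

theorem bddAbove_QEC_set {V : Type*} [Fintype V] (G : SimpleGraph V) :
    BddAbove {r : ℝ | ∃ f : V → ℝ, (∑ x, f x ^ 2) = 1 ∧ (∑ x, f x) = 0 ∧
      r = ∑ x, ∑ y, f x * (G.dist x y : ℝ) * f y} := by
  refine ⟨∑ x, ∑ y, (G.dist x y : ℝ), ?_⟩
  rintro r ⟨f, hf, -, rfl⟩
  have hle : ∀ x, f x ^ 2 ≤ 1 := fun x =>
    hf ▸ Finset.single_le_sum (f := fun x => f x ^ 2) (fun _ _ => sq_nonneg _)
      (Finset.mem_univ x)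
  refine Finset.sum_le_sum fun x _ => Finset.sum_le_sum fun y _ => ?_
  have hxy : f x * f y ≤ 1 := by nlinarith [hle x, hle y, sq_nonneg (f x - f y)]
  nlinarith [mul_le_mul_of_nonneg_right hxy (Nat.cast_nonneg (α := ℝ) (G.dist x y))]

theorem quadForm_le_QEC_mul {V : Type*} [Fintype V] (G : SimpleGraph V) (f : V → ℝ)
    (h0 : ∑ x, f x = 0) :
    ∑ x, ∑ y, f x * (G.dist x y : ℝ) * f y ≤ QEC G * ∑ x, f x ^ 2 := by
  have hN : 0 ≤ ∑ x, f x ^ 2 := Finset.sum_nonneg fun _ _ => sq_nonneg _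
  rcases hN.eq_or_lt with hz | hpos
  · have hf : ∀ x, f x = 0 := by
      intro x
      have := (Finset.sum_eq_zero_iff_of_nonneg fun _ _ => sq_nonneg _).1 hz.symm x
        (Finset.mem_univ x)
      simpa using this
    simp [hf]
  · rw [← div_le_iff₀ hpos]
    refine le_csSup (bddAbove_QEC_set G)
      ⟨fun x => (√(∑ x, f x ^ 2))⁻¹ * f x, ?_, ?_, ?_⟩
    · simp_rw [mul_pow, inv_pow, Real.sq_sqrt hN, ← Finset.mul_sum]
      exact inv_mul_cancel₀ hpos.ne'
    · rw [← Finset.mul_sum, h0, mul_zero]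
    · have hs : (√(∑ x, f x ^ 2))⁻¹ * (√(∑ x, f x ^ 2))⁻¹ = (∑ x, f x ^ 2)⁻¹ := by
        rw [← mul_inv, Real.mul_self_sqrt hN]
      rw [div_eq_inv_mul, ← hs]
      simp_rw [Finset.mul_sum]
      exact Finset.sum_congr rfl fun x _ => Finset.sum_congr rfl fun y _ => by ring

/-- The quadratic form inequality for a function supported on the image of an injection. -/
theorem quadForm_comp_le_QEC_mul {V W : Type*} [Fintype V] [Fintype W] (K : SimpleGraph W)
    (φ : V → W) (hφ : Function.Injective φ) (f : V → ℝ) (h0 : ∑ x, f x = 0) :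
    ∑ x, ∑ y, f x * (K.dist (φ x) (φ y) : ℝ) * f y ≤ QEC K * ∑ x, f x ^ 2 := by
  let g : W → ℝ := Function.extend φ f 0
  have hgφ : ∀ v, g (φ v) = f v := fun v => hφ.extend_apply f _ v
  have hg0 : ∀ w, w ∉ Set.range φ → g w = 0 := fun w hw =>
    Function.extend_apply' f _ w (by simpa using hw)
  have hsum : ∑ x, f x = ∑ w, g w :=
    Fintype.sum_of_injective φ hφ _ _ hg0 fun v => (hgφ v).symm
  have hsq : ∑ x, f x ^ 2 = ∑ w, g w ^ 2 :=
    Fintype.sum_of_injective φ hφ _ _ (fun w hw => by simp [hg0 w hw]) fun v => by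
      rw [hgφ]
  have hquad : ∑ x, ∑ y, f x * (K.dist (φ x) (φ y) : ℝ) * f y =
      ∑ w, ∑ z, g w * (K.dist w z : ℝ) * g z :=
    Fintype.sum_of_injective φ hφ _ _ (fun w hw => by simp [hg0 w hw]) fun v =>
      Fintype.sum_of_injective φ hφ _ _ (fun z hz => by simp [hg0 z hz]) fun u => by
        rw [hgφ, hgφ]
  rw [hquad, hsq]
  exact quadForm_le_QEC_mul K g (hsum ▸ h0)

/-- The quadratic embedding constant is monotone under isometric embeddings. -/
theorem QEC_le_of_isometric {V W : Type*} [Fintype V] [Fintype W] [Nontrivial V]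
    {G : SimpleGraph V} {K : SimpleGraph W} (φ : V → W) (hφ : Function.Injective φ)
    (hd : ∀ x y, K.dist (φ x) (φ y) = G.dist x y) : QEC G ≤ QEC K := by
  refine csSup_le ?_ ?_
  · obtain ⟨a, b, hab⟩ := exists_pair_ne V
    have hsq : ∀ x, ((Pi.single a (√2)⁻¹ : V → ℝ) x - (Pi.single b (√2)⁻¹ : V → ℝ) x) ^ 2 =
        (Pi.single a 2⁻¹ : V → ℝ) x + (Pi.single b 2⁻¹ : V → ℝ) x := by
      intro x
      by_cases ha : x = a
      · subst ha
        simp [Pi.single_eq_of_ne hab]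
      · by_cases hb : x = b
        · subst hb
          simp [Pi.single_eq_of_ne ha]
        · simp [Pi.single_eq_of_ne ha, Pi.single_eq_of_ne hb]
    refine ⟨_, fun x => (Pi.single a (√2)⁻¹ : V → ℝ) x - (Pi.single b (√2)⁻¹ : V → ℝ) x, ?_, ?_, rfl⟩
    · simp_rw [hsq, Finset.sum_add_distrib, Finset.sum_pi_single']
      norm_num
    · simp
  · rintro r ⟨f, hf, h0, rfl⟩
    simpa [hd, hf] using quadForm_comp_le_QEC_mul K φ hφ f h0

theorem cone_connected {V₂ : Type*} (H : SimpleGraph V₂) : (cone H).Connected := by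
  refine SimpleGraph.connected_iff_exists_forall_reachable _ |>.2 ⟨none, ?_⟩
  rintro (_ | x)
  · rfl
  · exact SimpleGraph.Adj.reachable (Or.inr (Or.inl ⟨rfl, by simp⟩))

/-- The copy of `G` inside `G ⊙ H`. -/
def coronaBase {V₁ V₂ : Type*} (G : SimpleGraph V₁) (H : SimpleGraph V₂) :
    G →g corona G H where
  toFun i := (i, none)
  map_rel' h := Or.inr ⟨h, rfl, rfl⟩

/-- The copy of `K₁ + H` attached at the vertex `i` of `G` inside `G ⊙ H`. -/
def coronaFiber {V₁ V₂ : Type*} (G : SimpleGraph V₁) (H : SimpleGraph V₂) (i : V₁) :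
    cone H →g corona G H where
  toFun x := (i, x)
  map_rel' h := Or.inl ⟨rfl, h⟩

theorem corona_connected {V₁ V₂ : Type*} {G : SimpleGraph V₁} (H : SimpleGraph V₂)
    (hG : G.Connected) : (corona G H).Connected := by
  obtain ⟨i⟩ := hG.nonempty
  refine SimpleGraph.connected_iff_exists_forall_reachable _ |>.2 ⟨(i, none), ?_⟩
  rintro ⟨j, x⟩
  exact ((hG.preconnected i j).map (coronaBase G H)).trans
    (((cone_connected H).preconnected none x).map (coronaFiber G H j))

theorem QEC_le_QEC_corona {V₁ V₂ : Type*} [Fintype V₁] [Fintype V₂] [Nontrivial V₁]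
    {G : SimpleGraph V₁} (H : SimpleGraph V₂) (hG : G.Connected) :
    QEC G ≤ QEC (corona G H) := by
  refine QEC_le_of_isometric (coronaBase G H) (fun i j h => congrArg Prod.fst h)
    (dist_eq_of_retraction hG (coronaBase G H) Prod.fst (fun _ => rfl) ?_)
  rintro x y (⟨h, -⟩ | ⟨h, -, -⟩)
  · exact Or.inl h
  · exact Or.inr h

theorem QEC_cone_le_QEC_corona {V₁ V₂ : Type*} [Fintype V₁] [Fintype V₂] [Nonempty V₁]
    [Nonempty V₂] (G : SimpleGraph V₁) (H : SimpleGraph V₂) :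
    QEC (cone H) ≤ QEC (corona G H) := by
  obtain ⟨i⟩ := ‹Nonempty V₁›
  refine QEC_le_of_isometric (coronaFiber G H i) (fun x y h => congrArg Prod.snd h)
    (dist_eq_of_retraction (cone_connected H) (coronaFiber G H i)
      (fun p => if p.1 = i then p.2 else none) (fun _ => if_pos rfl) ?_)
  rintro ⟨j, x⟩ ⟨k, y⟩ (⟨rfl, h⟩ | ⟨-, rfl, rfl⟩)
  · by_cases hj : j = i
    · simpa [hj] using Or.inr h
    · simp [hj]
  · simp

/-- The path `(i, a), (i, o), (j, o), (j, a)` in `G ⊙ H` is isometric, and the quadratic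
embedding constant of the path on four vertices is `-2 + √2`. -/
theorem neg_two_add_sqrt_two_le_QEC_corona {V₁ V₂ : Type*} [Fintype V₁] [Fintype V₂]
    [Nontrivial V₁] [Nonempty V₂] {G : SimpleGraph V₁} (H : SimpleGraph V₂)
    (hG : G.Connected) : -2 + √2 ≤ QEC (corona G H) := by
  obtain ⟨a⟩ := ‹Nonempty V₂›
  obtain ⟨i⟩ := hG.nonempty
  obtain ⟨j, hij⟩ := hG.preconnected.exists_adj_of_nontrivial i
  have hne : j ≠ i := hij.ne'
  have hK := corona_connected H hG
  have d01 : (corona G H).dist (i, some a) (i, none) = 1 :=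
    SimpleGraph.dist_eq_one_iff_adj.2 (Or.inl ⟨rfl, Or.inr (Or.inr ⟨by simp, rfl⟩)⟩)
  have d12 : (corona G H).dist (i, none) (j, none) = 1 :=
    SimpleGraph.dist_eq_one_iff_adj.2 (Or.inr ⟨hij, rfl, rfl⟩)
  have d23 : (corona G H).dist (j, none) (j, some a) = 1 :=
    SimpleGraph.dist_eq_one_iff_adj.2 (Or.inl ⟨rfl, Or.inr (Or.inl ⟨rfl, by simp⟩)⟩)
  let ht : V₁ × Option V₂ → ℕ := fun p =>
    if p.1 = i then (if p.2 = none then 1 else 0) else (if p.2 = none then 2 else 3)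
  have hlip : ∀ x y, (corona G H).Adj x y → ht x ≤ ht y + 1 := by
    rintro ⟨k, x⟩ ⟨l, y⟩ (⟨rfl, -⟩ | ⟨-, rfl, rfl⟩) <;> simp only [ht] <;> split_ifs <;> simp
  have low (x y) := le_add_dist ht hlip (hK.preconnected x y)
  have tri (x y z) := hK.dist_triangle (u := x) (v := y) (w := z)
  have d02 : (corona G H).dist (i, some a) (j, none) = 2 := by
    have h1 := tri (i, some a) (i, none) (j, none)
    have h2 := low (j, none) (i, some a)
    rw [SimpleGraph.dist_comm] at h2
    simp [ht, hne] at h2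
    omega
  have d13 : (corona G H).dist (i, none) (j, some a) = 2 := by
    have h1 := tri (i, none) (j, none) (j, some a)
    have h2 := low (j, some a) (i, none)
    rw [SimpleGraph.dist_comm] at h2
    simp [ht, hne] at h2
    omega
  have d03 : (corona G H).dist (i, some a) (j, some a) = 3 := by
    have h1 := tri (i, some a) (i, none) (j, some a)
    have h2 := low (j, some a) (i, some a)
    rw [SimpleGraph.dist_comm] at h2
    simp [ht, hne] at h2
    omega
  have hinj : Function.Injective
      (![(i, some a), (i, none), (j, none), (j, some a)] : Fin 4 → V₁ × Option V₂) := by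
    intro x y h
    fin_cases x <;> fin_cases y <;> simp_all
  have key := quadForm_comp_le_QEC_mul (corona G H) _ hinj
    ![1, -1 - √2, 1 + √2, -1] (by simp [Fin.sum_univ_four]; ring)
  have hs : √2 ^ 2 = 2 := Real.sq_sqrt (by norm_num)
  have d10 := SimpleGraph.dist_comm.trans d01
  have d21 := SimpleGraph.dist_comm.trans d12
  have d32 := SimpleGraph.dist_comm.trans d23
  have d20 := SimpleGraph.dist_comm.trans d02
  have d31 := SimpleGraph.dist_comm.trans d13
  have d30 := SimpleGraph.dist_comm.trans d03
  simp [Fin.sum_univ_four, d01, d12, d23, d02, d13, d03, d10, d21, d32, d20, d31, d30] at key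
  have hpos : 0 < 8 + 4 * √2 := by positivity
  refine le_of_mul_le_mul_right ?_ hpos
  linear_combination key + (6 + 2 * QEC (corona G H)) * hs

/-- `QEC(G⊙H) ≥ max{−2+√2, QEC(G), QEC(K₁+H)}`. -/
theorem qec_corona_lower_bound {V₁ V₂ : Type*} [Fintype V₁] [Fintype V₂]
    (G : SimpleGraph V₁) (H : SimpleGraph V₂) (hG : G.Connected)
    (hV₁ : 2 ≤ Fintype.card V₁) (hV₂ : 1 ≤ Fintype.card V₂) :
    max (-2 + Real.sqrt 2) (max (QEC G) (QEC (cone H))) ≤ QEC (corona G H) := by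
  have : Nontrivial V₁ := Fintype.one_lt_card_iff_nontrivial.1 hV₁
  have : Nonempty V₂ := Fintype.card_pos_iff.1 hV₂
  exact max_le (neg_two_add_sqrt_two_le_QEC_corona H hG)
    (max_le (QEC_le_QEC_corona H hG) (QEC_cone_le_QEC_corona G H))

end QECPaper
end

section
/- Let G = (V₁,E₁) be a connected graph with |V₁| ≥ 2 and H = (V₂,E₂) an arbitrary graph with |V₂| ≥ 1, with adjacency matrix A_H. If (i) −2 − ψ_{H*}⁻¹(QEC(G)) ∉ ev(A_H) and (ii) min ev(A_H) > −√2, then QEC(G⊙H) = ψ_{H*}⁻¹(QEC(G)). -/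
open scoped BigOperators
open Filter Topology
open scoped Classical

namespace QECPaper

/-- A function that vanishes exactly at `t`, is `1`-Lipschitz along edges and strictly decreases
along some edge out of every other vertex is the distance to `t`. -/
lemma dist_eq_of_potential {V : Type*} (G : SimpleGraph V) (t : V) (φ : V → ℕ)
    (hzero : ∀ a, φ a = 0 ↔ a = t) (hlip : ∀ a b, G.Adj a b → φ a ≤ φ b + 1)
    (hstep : ∀ a, a ≠ t → ∃ b, G.Adj a b ∧ φ b + 1 = φ a) (a : V) :
    G.dist a t = φ a := by
  have hupper : ∀ n a, φ a = n → ∃ p : G.Walk a t, p.length = n := by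
    intro n
    induction n with
    | zero =>
      intro a ha
      obtain rfl := (hzero a).1 ha
      exact ⟨.nil, rfl⟩
    | succ n ih =>
      intro a ha
      have hne : a ≠ t := fun h => by
        have := (hzero a).2 h
        omega
      obtain ⟨b, hab, hb⟩ := hstep a hne
      obtain ⟨p, hp⟩ := ih b (by omega)
      exact ⟨.cons hab p, by simp [hp]⟩
  have hlower : ∀ {a b} (p : G.Walk a b), φ a ≤ φ b + p.length := by
    intro a b p
    induction p with
    | nil => simp
    | cons h p ih =>
      have := hlip _ _ h
      simp only [SimpleGraph.Walk.length_cons]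
      omega
  obtain ⟨p, hp⟩ := hupper _ a rfl
  refine le_antisymm (hp ▸ SimpleGraph.dist_le p) ?_
  obtain ⟨p', hp'⟩ := p.reachable.exists_walk_length_eq_dist
  have := hlower p'
  rw [(hzero t).2 rfl] at this
  omega

/-- The distance in `G ⊙ H`, written out explicitly. -/
noncomputable def coronaDist {V₁ V₂ : Type*} (G : SimpleGraph V₁) (H : SimpleGraph V₂) :
    V₁ × Option V₂ → V₁ × Option V₂ → ℕ
  | (i, none), (j, none) => G.dist i j
  | (i, none), (j, some _) => G.dist i j + 1
  | (i, some _), (j, none) => G.dist i j + 1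
  | (i, some a), (j, some b) =>
    if i = j then (if a = b then 0 else if H.Adj a b then 1 else 2) else G.dist i j + 2

lemma exists_adj_dist_succ_eq {V : Type*} {G : SimpleGraph V} (hG : G.Connected) {i j : V}
    (hij : i ≠ j) : ∃ k, G.Adj i k ∧ G.dist k j + 1 = G.dist i j := by
  obtain ⟨p, hp⟩ := hG.exists_walk_length_eq_dist i j
  cases p with
  | nil => exact absurd rfl hij
  | cons h p =>
    refine ⟨_, h, ?_⟩
    have h1 := SimpleGraph.dist_le p
    rename_i k
    have h3 : G.dist i j ≤ G.dist i k + G.dist k j := hG.dist_triangle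
    rw [SimpleGraph.dist_eq_one_iff_adj.2 h] at h3
    simp only [SimpleGraph.Walk.length_cons] at hp
    omega

lemma dist_le_dist_succ_of_adj {V : Type*} {G : SimpleGraph V} (hG : G.Connected) {i k : V}
    (h : G.Adj i k) (j : V) : G.dist i j ≤ G.dist k j + 1 := by
  have h3 : G.dist i j ≤ G.dist i k + G.dist k j := hG.dist_triangle
  rw [SimpleGraph.dist_eq_one_iff_adj.2 h] at h3
  omega

lemma dist_corona {V₁ V₂ : Type*} {G : SimpleGraph V₁} (hG : G.Connected) (H : SimpleGraph V₂)
    (p q : V₁ × Option V₂) : (corona G H).dist p q = coronaDist G H p q := by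
  obtain ⟨j, y⟩ := q
  refine dist_eq_of_potential _ (j, y) (fun p => coronaDist G H p (j, y)) ?_ ?_ ?_ p
  · rintro ⟨i, x | a⟩ <;> cases y <;> simp [coronaDist, hG.dist_eq_zero_iff]
    split_ifs <;> simp_all
  · rintro ⟨i, x⟩ ⟨k, z⟩ (⟨h, h'⟩ | ⟨h, h', h''⟩)
    · dsimp only at h h'
      subst h
      rcases h' with ⟨a, b, rfl, rfl, hab⟩ | ⟨rfl, hz⟩ | ⟨hx, rfl⟩
      · cases y
        · simp [coronaDist]
        · simp only [coronaDist]
          split_ifs <;> simp_all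
      · obtain ⟨b, rfl⟩ := Option.ne_none_iff_exists'.1 hz
        cases y <;> simp only [coronaDist] <;> (try split_ifs) <;> (simp_all; try omega)
      · obtain ⟨b, rfl⟩ := Option.ne_none_iff_exists'.1 hx
        cases y <;> simp only [coronaDist] <;> (try split_ifs) <;> simp_all
    · dsimp only at h h' h''
      subst h' h''
      have := dist_le_dist_succ_of_adj hG h j
      cases y <;> simp only [coronaDist] <;> omega
  · rintro ⟨i, x⟩ hne
    by_cases hij : i = j
    · subst hij
      cases x with
      | none =>
        cases y with
        | none => exact absurd rfl hne
        | some b => exact ⟨(i, some b), by simp [corona, cone], by simp [coronaDist]⟩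
      | some a =>
        cases y with
        | none => exact ⟨(i, none), by simp [corona, cone], by simp [coronaDist]⟩
        | some b =>
          have hab : a ≠ b := fun h => hne (by rw [h])
          by_cases h : H.Adj a b
          · exact ⟨(i, some b), by simp [corona, cone, h], by simp [coronaDist, h, hab]⟩
          · exact ⟨(i, none), by simp [corona, cone], by simp [coronaDist, h, hab]⟩
    · cases x with
      | none =>
        obtain ⟨k, hk, hd⟩ := exists_adj_dist_succ_eq hG hij
        refine ⟨(k, none), by simp [corona, hk], ?_⟩
        cases y <;> simp only [coronaDist] <;> omega
      | some a =>
        refine ⟨(i, none), by simp [corona, cone], ?_⟩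
        cases y <;> simp [coronaDist, hij]

/-- The quadratic form of the distance matrix of `G ⊙ H` in terms of the fibrewise sums. -/
lemma sum_dist_corona {V₁ V₂ : Type*} [Fintype V₁] [Fintype V₂] [DecidableEq V₂]
    {G : SimpleGraph V₁} (hG : G.Connected) (H : SimpleGraph V₂) [DecidableRel H.Adj]
    (f : V₁ × Option V₂ → ℝ) (hf : ∑ p, f p = 0) :
    ∑ p, ∑ q, f p * ((corona G H).dist p q : ℝ) * f q =
      (∑ i, ∑ j, (∑ x, f (i, x)) * (G.dist i j : ℝ) * (∑ x, f (j, x))) -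
        ∑ i, (fun a => f (i, some a)) ⬝ᵥ
          ((H.adjMatrix ℝ + (2 : ℝ) • 1).mulVec fun a => f (i, some a)) := by
  let c : Option V₂ → ℝ := fun x => if x = none then 0 else 1
  let M : Option V₂ → Option V₂ → ℝ
    | some a, some b => (H.adjMatrix ℝ + (2 : ℝ) • (1 : Matrix V₂ V₂ ℝ)) a b
    | _, _ => 0
  have hd : ∀ i x j y, ((corona G H).dist (i, x) (j, y) : ℝ) =
      G.dist i j + c x + c y - if i = j then M x y else 0 := by
    intro i x j y
    rw [dist_corona hG]
    cases x <;> cases y <;> simp [coronaDist, c, M]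
    rename_i a b
    by_cases hij : i = j
    · subst hij
      by_cases hab : a = b
      · subst hab
        simp
        norm_num
      · by_cases h : H.Adj a b
        · simp [hab, h]
        · simp [hab, h]
          norm_num
    · simp [hij]
      ring
  have hzero : ∑ j, ∑ y, f (j, y) = 0 := by rw [← Fintype.sum_prod_type, hf]
  simp only [Fintype.sum_prod_type, hd]
  have hsplit : ∀ i x j y, f (i, x) * ((G.dist i j : ℝ) + c x + c y - if i = j then M x y else 0) *
      f (j, y) = f (i, x) * G.dist i j * f (j, y) + (f (i, x) * c x) * f (j, y) +
        f (i, x) * (c y * f (j, y)) - f (i, x) * (if i = j then M x y else 0) * f (j, y) := by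
    intros
    ring
  simp only [hsplit, Finset.sum_sub_distrib, Finset.sum_add_distrib]
  have h2 : ∑ i, ∑ x, ∑ j, ∑ y, f (i, x) * c x * f (j, y) = 0 := by
    simp only [← Finset.mul_sum, hzero, mul_zero, Finset.sum_const_zero]
  have h3 : ∑ i, ∑ x, ∑ j, ∑ y, f (i, x) * (c y * f (j, y)) = 0 := by
    simp only [← Finset.mul_sum, ← Finset.sum_mul, hzero, zero_mul]
  rw [h2, h3]
  congr 1
  · simp only [add_zero]
    refine Finset.sum_congr rfl fun i _ => ?_
    rw [Finset.sum_comm]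
    refine Finset.sum_congr rfl fun j _ => ?_
    simp only [Finset.sum_mul, Finset.mul_sum]
    exact Finset.sum_comm
  · refine Finset.sum_congr rfl fun i _ => ?_
    simp [Fintype.sum_option, M, dotProduct, Matrix.mulVec, Finset.mul_sum, mul_assoc]

/-- The all-ones vector is the sum of its components in the eigenspaces of the main eigenvalues. -/
lemma exists_main_decomposition {ι : Type*} [Fintype ι] [DecidableEq ι] {A : Matrix ι ι ℝ}
    (hA : A.IsHermitian) :
    ∃ (S : Finset ℝ) (u : ℝ → ι → ℝ), (S : Set ℝ) = mainEv A ∧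
      (∀ α, A.mulVec (u α) = α • u α) ∧ (∀ α, ∑ x, u α x = projNormSq A α) ∧
      ∑ α ∈ S, u α = 1 := by
  have hT := Matrix.isSymmetric_toEuclideanLin_iff.2 hA
  have heig : ∀ α, eigSpace A α = Module.End.eigenspace (Matrix.toEuclideanLin A) α := by
    intro α
    ext x
    simp [eigSpace, sub_eq_zero]
  have hsum := hT.orthogonalFamily_eigenspaces'.sum_projection_of_mem_iSup (onesE ι) (by
    have htop := Submodule.orthogonal_eq_bot_iff.1 hT.orthogonalComplement_iSup_eigenspaces_eq_bot'
    exact htop.symm ▸ Submodule.mem_top)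
  let P : ℝ → EuclideanSpace ℝ ι := fun α => (eigSpace A α).starProjection (onesE ι)
  have hP : ∀ α, P α = ((eigSpace A α).orthogonalProjectionOnto (onesE ι) : EuclideanSpace ℝ ι) :=
    fun _ => rfl
  have hmain : ∀ α, α ∈ mainEv A ↔ P α ≠ 0 := by
    intro α
    simp only [mainEv, Set.mem_ofPred_eq, projNormSq, ← hP]
    simp
  have hsum' : ∑ μ : Module.End.Eigenvalues (Matrix.toEuclideanLin A), P (μ : ℝ) = onesE ι := by
    rw [← hsum]
    refine Finset.sum_congr rfl fun μ _ => ?_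
    simp only [P, heig]
  let S : Finset ℝ := (Finset.univ.image fun μ : Module.End.Eigenvalues (Matrix.toEuclideanLin A) =>
    (μ : ℝ)).filter fun α => P α ≠ 0
  have hPmem : ∀ α, P α ∈ eigSpace A α := fun α => Submodule.coe_mem _
  refine ⟨S, fun α => (P α).ofLp, ?_, ?_, ?_, ?_⟩
  · ext α
    simp only [S, hmain, Finset.coe_filter, Set.mem_ofPred_eq, Finset.mem_image, Finset.mem_univ,
      true_and, and_iff_right_iff_imp]
    intro h
    exact ⟨⟨α, Module.End.hasEigenvalue_of_hasEigenvector ⟨(heig α).le (hPmem α), h⟩⟩, rfl⟩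
  · intro α
    have h := hPmem α
    rw [heig, Module.End.mem_eigenspace_iff] at h
    have := congrArg WithLp.ofLp h
    simpa using this
  · intro α
    have h := Submodule.re_inner_starProjection_eq_normSq (eigSpace A α) (onesE ι)
    rw [RCLike.re_to_real] at h
    rw [projNormSq, Submodule.norm_coe, ← h]
    simp [P, PiLp.inner_apply, onesE]
  · have h1 : ∑ α ∈ S, P α = onesE ι := by
      rw [← hsum', Finset.sum_filter_ne_zero, Finset.sum_image]
      exact fun _ _ _ _ h => Subtype.ext h
    have := congrArg WithLp.ofLp h1
    rw [WithLp.ofLp_sum] at this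
    rw [this]
    rfl

/-- The quadratic form of the distance matrix attains its maximum `QEC G` on the unit vectors
orthogonal to the constants. -/
lemma qec_attained {V : Type*} [Fintype V] (G : SimpleGraph V) (hV : 2 ≤ Fintype.card V) :
    (∃ f : V → ℝ, (∑ x, f x ^ 2) = 1 ∧ (∑ x, f x) = 0 ∧
      ∑ x, ∑ y, f x * (G.dist x y : ℝ) * f y = QEC G) ∧
    ∀ f : V → ℝ, (∑ x, f x) = 0 →
      ∑ x, ∑ y, f x * (G.dist x y : ℝ) * f y ≤ QEC G * ∑ x, f x ^ 2 := by
  let F : (V → ℝ) → ℝ := fun f => ∑ x, ∑ y, f x * (G.dist x y : ℝ) * f y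
  have hF : Continuous F := by fun_prop
  let K : Set (V → ℝ) := {f | (∑ x, f x ^ 2) = 1 ∧ (∑ x, f x) = 0}
  have hscale : ∀ f : V → ℝ, f ≠ 0 → (∑ x, f x) = 0 →
      0 < ∑ x, f x ^ 2 ∧ (fun x => f x / √(∑ x, f x ^ 2)) ∈ K := by
    intro f hf hsum
    have hpos : 0 < ∑ x, f x ^ 2 := by
      obtain ⟨x, hx⟩ := Function.ne_iff.1 hf
      exact Finset.sum_pos' (fun _ _ => sq_nonneg _) ⟨x, Finset.mem_univ _, by
        have : f x ≠ 0 := hx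
        positivity⟩
    refine ⟨hpos, ?_, ?_⟩
    · simp only [div_pow, Real.sq_sqrt hpos.le, ← Finset.sum_div]
      exact div_self hpos.ne'
    · rw [← Finset.sum_div, hsum, zero_div]
  have hKc : IsCompact K := by
    refine Metric.isCompact_of_isClosed_isBounded ?_ ?_
    · exact (isClosed_eq (by fun_prop) continuous_const).inter
        (isClosed_eq (by fun_prop) continuous_const)
    · refine (Metric.isBounded_closedBall (x := (0 : V → ℝ)) (r := 1)).subset fun f hf => ?_
      rw [mem_closedBall_zero_iff, pi_norm_le_iff_of_nonneg zero_le_one]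
      intro x
      have h1 : f x ^ 2 ≤ ∑ y, f y ^ 2 :=
        Finset.single_le_sum (f := fun y => f y ^ 2) (fun _ _ => sq_nonneg _) (Finset.mem_univ x)
      rw [hf.1] at h1
      rw [Real.norm_eq_abs]
      exact (sq_le_one_iff_abs_le_one _).1 h1
  have hKne : K.Nonempty := by
    obtain ⟨a, b, hab⟩ := Fintype.exists_pair_of_one_lt_card (α := V) (by omega)
    refine ⟨_, (hscale (Pi.single a 1 - Pi.single b 1) ?_ ?_).2⟩
    · intro h
      simpa [hab] using congrFun h a
    · simp
  have himg : QEC G = sSup (F '' K) := by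
    rw [QEC]
    congr 1
    ext r
    constructor
    · rintro ⟨f, h1, h2, rfl⟩
      exact ⟨f, ⟨h1, h2⟩, rfl⟩
    · rintro ⟨f, ⟨h1, h2⟩, rfl⟩
      exact ⟨f, h1, h2, rfl⟩
  have hc := hKc.image hF
  constructor
  · obtain ⟨f, ⟨h1, h2⟩, h3⟩ := hc.sSup_mem (hKne.image F)
    exact ⟨f, h1, h2, h3.trans himg.symm⟩
  · intro f hsum
    by_cases hf : f = 0
    · simp [hf]
    · obtain ⟨hpos, hmem⟩ := hscale f hf hsum
      have h1 := le_csSup hc.bddAbove ⟨_, hmem, rfl⟩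
      rw [← himg] at h1
      have h2 : F (fun x => f x / √(∑ x, f x ^ 2)) = F f / ∑ x, f x ^ 2 := by
        simp only [F, Finset.sum_div]
        refine Finset.sum_congr rfl fun x _ => Finset.sum_congr rfl fun y _ => ?_
        rw [div_mul_eq_mul_div, div_mul_div_comm, Real.mul_self_sqrt hpos.le]
      rwa [h2, div_le_iff₀ hpos] at h1

lemma neg_one_le_qec {V : Type*} [Fintype V] {G : SimpleGraph V} (hG : G.Connected)
    (hV : 2 ≤ Fintype.card V) : -1 ≤ QEC G := by
  obtain ⟨a, b, hab⟩ := Fintype.exists_pair_of_one_lt_card (α := V) (by omega)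
  obtain ⟨c, hac, -⟩ := exists_adj_dist_succ_eq hG hab
  have hne : a ≠ c := hac.ne
  have h := (qec_attained G hV).2 (Pi.single a 1 - Pi.single c 1) (by simp)
  have h1 : ∑ x, (Pi.single a 1 - Pi.single c 1 : V → ℝ) x ^ 2 = 2 := by
    have : ∀ x, (Pi.single a 1 - Pi.single c 1 : V → ℝ) x ^ 2 =
        (Pi.single a 1 : V → ℝ) x + (Pi.single c 1 : V → ℝ) x := by
      intro x
      by_cases hx : x = a
      · subst hx
        simp [hne]
      · by_cases hx' : x = c
        · subst hx'
          simp [hx]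
        · simp [hx, hx']
    simp only [this, Finset.sum_add_distrib]
    simp
    norm_num
  have h2 : ∑ x, ∑ y, (Pi.single a 1 - Pi.single c 1 : V → ℝ) x * (G.dist x y : ℝ) *
      (Pi.single a 1 - Pi.single c 1 : V → ℝ) y = -2 := by
    simp only [Pi.sub_apply, sub_mul, mul_sub, Finset.sum_sub_distrib, Pi.single_apply]
    simp [SimpleGraph.dist_comm (u := c) (v := a), SimpleGraph.dist_eq_one_iff_adj.2 hac]
    norm_num
  rw [h1, h2] at h
  linarith

section PsiInverse

variable {ι : Type*} [Fintype ι] [DecidableEq ι] {A : Matrix ι ι ℝ} {S : Finset ℝ}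

lemma omegaFun_eq (hS : (S : Set ℝ) = mainEv A) (hlb : ∀ α ∈ S, -2 < α) (l : ℝ) :
    omegaFun A l = 1 + l * ∑ α ∈ S, projNormSq A α / (α + 2 + l) := by
  have hmem : (-2 : ℝ) ∉ mainEv A := by
    rw [← hS]
    exact fun h => lt_irrefl _ (hlb _ h)
  have hzero : projNormSq A (-2) = 0 := not_not.1 hmem
  rw [omegaFun, Set.sdiff_singleton_eq_self hmem, hzero, add_zero, ← hS, finsum_mem_coe_finset,
    Finset.mul_sum]
  congr 1
  exact Finset.sum_congr rfl fun _ _ => by ring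

lemma projNormSq_pos (hS : (S : Set ℝ) = mainEv A) {α : ℝ} (hα : α ∈ S) :
    0 < projNormSq A α := by
  have h : α ∈ mainEv A := hS ▸ hα
  exact lt_of_le_of_ne (sq_nonneg _) (Ne.symm h)

lemma sum_projNormSq_div_anti (hS : (S : Set ℝ) = mainEv A) {l m : ℝ}
    (hpole : ∀ α ∈ S, 0 < α + 2 + l) (hlm : l ≤ m) :
    ∑ α ∈ S, projNormSq A α / (α + 2 + m) ≤ ∑ α ∈ S, projNormSq A α / (α + 2 + l) :=
  Finset.sum_le_sum fun α hα =>
    div_le_div_of_nonneg_left (projNormSq_pos hS hα).le (hpole α hα) (by linarith)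

lemma omegaFun_strictMono (hS : (S : Set ℝ) = mainEv A) (hne : S.Nonempty)
    (hlb : ∀ α ∈ S, -2 < α) {l m : ℝ} (hpole : ∀ α ∈ S, 0 < α + 2 + l) (hlm : l < m) :
    omegaFun A l < omegaFun A m := by
  rw [omegaFun_eq hS hlb, omegaFun_eq hS hlb, Finset.mul_sum, Finset.mul_sum]
  refine add_lt_add_right (Finset.sum_lt_sum_of_nonempty hne fun α hα => ?_) _
  have h1 := hpole α hα
  have h2 := hlb α hα
  have h3 := projNormSq_pos hS hα
  rw [← mul_div_assoc, ← mul_div_assoc, div_lt_div_iff₀ h1 (by linarith)]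
  nlinarith [mul_pos (mul_pos h3 (sub_pos.2 hlm)) (by linarith : 0 < α + 2)]

/-- The largest zero of the `ω`-function is negative and lies to the right of all poles. -/
lemma lamStar_spec (hS : (S : Set ℝ) = mainEv A) (hne : S.Nonempty) (hlb : ∀ α ∈ S, -2 < α) :
    lamStar A < 0 ∧ (∀ α ∈ S, 0 < α + 2 + lamStar A) ∧ omegaFun A (lamStar A) = 0 := by
  obtain ⟨β, hβ, hβmin⟩ := S.exists_min_image id hne
  simp only [id] at hβmin
  have hn := projNormSq_pos hS hβ
  have hb : 0 < β + 2 := by linarith [hlb β hβ]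
  let l := -(β + 2) / (1 + projNormSq A β)
  have hl : l < 0 := div_neg_of_neg_of_pos (by linarith) (by linarith)
  have hbl : 0 < β + 2 + l := by
    have : β + 2 + l = (β + 2) * projNormSq A β / (1 + projNormSq A β) := by
      simp only [l]
      field_simp
      ring
    rw [this]
    positivity
  have hpole : ∀ α ∈ S, 0 < α + 2 + l := fun α hα => by linarith [hβmin α hα]
  have hω : omegaFun A l ≤ 0 := by
    have h1 : projNormSq A β / (β + 2 + l) ≤ ∑ α ∈ S, projNormSq A α / (α + 2 + l) :=
      Finset.single_le_sum (f := fun α => projNormSq A α / (α + 2 + l))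
        (fun α hα => (div_pos (projNormSq_pos hS hα) (hpole α hα)).le) hβ
    have h2 : 1 + l * (projNormSq A β / (β + 2 + l)) = 0 := by
      have : l * (1 + projNormSq A β) = -(β + 2) := by
        simp only [l]
        field_simp
      field_simp
      linarith
    rw [omegaFun_eq hS hlb]
    linarith [mul_le_mul_of_nonpos_left h1 hl.le]
  have hcont : ContinuousOn (omegaFun A) (Set.Icc l 0) := by
    rw [funext (omegaFun_eq hS hlb)]
    refine continuousOn_const.add (continuousOn_id.mul (continuousOn_finsetSum _ fun α hα => ?_))
    refine continuousOn_const.div (by fun_prop) fun x hx => ?_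
    linarith [hpole α hα, hx.1]
  have hω0 : omegaFun A 0 = 1 := by simp [omegaFun_eq hS hlb]
  obtain ⟨z, hz, hzero⟩ := intermediate_value_Icc hl.le hcont ⟨hω, by rw [hω0]; norm_num⟩
  have hzpole : ∀ α ∈ S, 0 < α + 2 + z := fun α hα => by linarith [hpole α hα, hz.1]
  have hzneg : z < 0 := lt_of_le_of_ne hz.2 (by
    rintro rfl
    rw [hω0] at hzero
    norm_num at hzero)
  have hgreatest : IsGreatest (omegaZeros A) z := by
    refine ⟨⟨fun α hα => ?_, hzero⟩, fun x hx => ?_⟩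
    · have := hzpole α (by simpa [← hS] using hα.1)
      intro h
      linarith
    · by_contra! h
      have := omegaFun_strictMono hS hne hlb hzpole h
      rw [hzero, hx.2] at this
      exact lt_irrefl _ this
  rw [lamStar, hgreatest.csSup_eq]
  exact ⟨hzneg, hzpole, hzero⟩

/-- `psiStarInv A y` is a solution `l` of `l = y ω(l)` to the right of `λ*`, and `ψ` exceeds `y`
to the right of it. -/
lemma psiStarInv_spec (hS : (S : Set ℝ) = mainEv A) (hne : S.Nonempty) (hlb : ∀ α ∈ S, -2 < α)
    (y : ℝ) :
    0 < omegaFun A (psiStarInv A y) ∧ psiStarInv A y = y * omegaFun A (psiStarInv A y) ∧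
      ∀ m, psiStarInv A y < m → 0 < omegaFun A m ∧ y * omegaFun A m < m := by
  obtain ⟨hz, hzpole, hzero⟩ := lamStar_spec hS hne hlb
  set z := lamStar A with hzdef
  have hpole : ∀ x, z ≤ x → ∀ α ∈ S, 0 < α + 2 + x := fun x hx α hα => by
    linarith [hzpole α hα]
  have hpos : ∀ x, z < x → 0 < omegaFun A x := fun x hx => by
    rw [← hzero]
    exact omegaFun_strictMono hS hne hlb hzpole hx
  have hψ : ∀ x, z < x → psiFun A x = x / omegaFun A x := fun x hx => by
    rw [psiFun, if_neg]
    intro h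
    have := hpole x hx.le _ (by simpa [← hS] using h.1)
    linarith
  have hmono : ∀ x x', z < x → x < x' → x / omegaFun A x < x' / omegaFun A x' := by
    intro x x' hx hxx'
    have h1 := hpos x hx
    have h2 := hpos x' (hx.trans hxx')
    rw [div_lt_div_iff₀ h1 h2]
    by_cases hsign : 0 ≤ x * x'
    · rw [omegaFun_eq hS hlb, omegaFun_eq hS hlb]
      nlinarith [mul_le_mul_of_nonneg_left
        (sum_projNormSq_div_anti hS (hpole x hx.le) hxx'.le) hsign]
    · have hx0 : x < 0 := by
        by_contra! h
        exact hsign (mul_nonneg h (h.trans hxx'.le))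
      have hx0' : 0 < x' := by
        by_contra! h
        exact hsign (mul_nonneg_of_nonpos_of_nonpos hx0.le h)
      nlinarith [mul_pos hx0' h1, mul_pos (neg_pos.2 hx0) h2]
  obtain ⟨l, hzl, hly⟩ : ∃ l, z < l ∧ l = y * omegaFun A l := by
    let N := ∑ α ∈ S, projNormSq A α
    have hN : 0 ≤ N := Finset.sum_nonneg fun α hα => (projNormSq_pos hS hα).le
    let R := |y| * (1 + N)
    have hR : 0 ≤ R := by positivity
    have hωR : omegaFun A R ≤ 1 + N := by
      rw [omegaFun_eq hS hlb, Finset.mul_sum]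
      refine add_le_add_right (Finset.sum_le_sum fun α hα => ?_) _
      have h1 := projNormSq_pos hS hα
      have h2 : 0 < α + 2 + R := hpole R (hz.le.trans hR) α hα
      rw [← mul_div_assoc, div_le_iff₀ h2]
      nlinarith [mul_pos h1 (by linarith [hlb α hα] : 0 < α + 2)]
    have hcont : ContinuousOn (fun x => x - y * omegaFun A x) (Set.Icc z R) := by
      simp only [omegaFun_eq hS hlb]
      refine continuousOn_id.sub (continuousOn_const.mul (continuousOn_const.add
        (continuousOn_id.mul (continuousOn_finsetSum _ fun α hα => ?_))))
      refine continuousOn_const.div (by fun_prop) fun x hx => ?_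
      exact (hpole x hx.1 α hα).ne'
    have hωR0 := hpos R (hz.trans_le hR)
    have hyR : y * omegaFun A R ≤ R :=
      (mul_le_mul_of_nonneg_right (le_abs_self y) hωR0.le).trans
        (mul_le_mul_of_nonneg_left hωR (abs_nonneg y))
    obtain ⟨l, hl, hl0⟩ := intermediate_value_Icc (hz.le.trans hR) hcont
      (show (0 : ℝ) ∈ _ from ⟨by simp only [hzero]; linarith, by simpa using hyR⟩)
    dsimp only at hl0
    refine ⟨l, lt_of_le_of_ne hl.1 ?_, by linarith⟩
    rintro rfl
    rw [hzero] at hl0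
    linarith
  have hset : {x : ℝ | z < x ∧ psiFun A x = y} = {l} := by
    have hl : l / omegaFun A l = y := by
      rw [div_eq_iff (hpos l hzl).ne']
      exact hly
    ext x
    constructor
    · rintro ⟨hx, hxy⟩
      rw [hψ x hx, ← hl] at hxy
      rcases lt_trichotomy x l with h | h | h
      · exact absurd hxy (hmono x l hx h).ne
      · exact h
      · exact absurd hxy (hmono l x hzl h).ne'
    · rintro rfl
      exact ⟨hzl, by rw [hψ _ hzl, hl]⟩
  have hinv : psiStarInv A y = l := by
    rw [psiStarInv, ← hzdef, hset, csSup_singleton]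
  rw [hinv]
  refine ⟨hpos l hzl, hly, fun m hm => ⟨hpos m (hzl.trans hm), ?_⟩⟩
  have h := hmono l m hzl hm
  rwa [lt_div_iff₀ (hpos m (hzl.trans hm)), div_eq_iff (hpos l hzl).ne' |>.2 hly] at h

end PsiInverse

lemma neg_two_add_sqrt_two_le_psiStarInv {V : Type*} [Fintype V] [DecidableEq V]
    (H : SimpleGraph V) [DecidableRel H.Adj] (hV : 1 ≤ Fintype.card V) {S : Finset ℝ}
    {u : ℝ → V → ℝ} (hS : (S : Set ℝ) = mainEv (H.adjMatrix ℝ)) (hne : S.Nonempty)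
    (hu : ∀ α, (H.adjMatrix ℝ).mulVec (u α) = α • u α)
    (hsum : ∀ α, ∑ x, u α x = projNormSq (H.adjMatrix ℝ) α) (hone : ∑ α ∈ S, u α = 1)
    (hlb : ∀ α ∈ S, -√2 < α) {y : ℝ} (hy : -1 ≤ y) :
    -2 + √2 ≤ psiStarInv (H.adjMatrix ℝ) y := by
  set A := H.adjMatrix ℝ
  have hsq : √2 * √2 = 2 := Real.mul_self_sqrt zero_le_two
  have hsq1 : 1 < √2 := Real.lt_sqrt_of_sq_lt (by norm_num)
  have hsq2 : √2 < 2 := by nlinarith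
  have hlb2 : ∀ α ∈ S, -2 < α := fun α hα => by linarith [hlb α hα]
  have hcard : (1 : ℝ) ≤ Fintype.card V := by exact_mod_cast hV
  set N : ℝ := (Fintype.card V : ℝ) with hN
  have htotal : ∑ α ∈ S, projNormSq A α = N := by
    simp only [← hsum]
    rw [Finset.sum_comm]
    simp only [← Finset.sum_apply, hone]
    simp [hN]
  have hdegree : ∑ α ∈ S, α * projNormSq A α ≤ N * (N - 1) := by
    have h1 : ∑ α ∈ S, α * projNormSq A α = ∑ x, A.mulVec 1 x := by
      rw [← hone, Matrix.mulVec_sum]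
      simp only [hu, ← hsum, Finset.sum_apply, Finset.mul_sum]
      rw [Finset.sum_comm]
      rfl
    rw [h1, hN, ← nsmul_eq_mul, ← Finset.card_univ]
    refine Finset.sum_le_card_nsmul _ _ _ fun x _ => ?_
    have h2 : A.mulVec 1 x = H.degree x := by
      simp [A, Matrix.mulVec, dotProduct, SimpleGraph.adjMatrix_apply, SimpleGraph.degree,
        SimpleGraph.neighborFinset_eq_filter]
    have h3 : (H.degree x : ℝ) + 1 ≤ Fintype.card V := by exact_mod_cast H.degree_lt_card_verts x
    rw [h2, Finset.card_univ]
    linarith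
  by_contra! hlt
  obtain ⟨hpos, hbound⟩ := (psiStarInv_spec hS hne hlb2 y).2.2 _ hlt
  have hw : 1 / √2 ≤ ∑ α ∈ S, projNormSq A α / (α + 2 + (-2 + √2)) := by
    let c : ℝ := 1 / (N - 1 + √2)
    have hd : 0 < N - 1 + √2 := by linarith
    have hcd : c * (N - 1 + √2) = 1 := one_div_mul_cancel hd.ne'
    have hc : 0 < c := by positivity
    calc 1 / √2 ≤ c * N := by
          rw [show c * N = N / (N - 1 + √2) by ring, div_le_div_iff₀ (by linarith) hd]
          nlinarith
      _ ≤ 2 * c * N - c ^ 2 * (∑ α ∈ S, α * projNormSq A α + √2 * N) := by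
          have h1 : c ^ 2 * (∑ α ∈ S, α * projNormSq A α + √2 * N) ≤
              c ^ 2 * (N * (N - 1) + √2 * N) := by gcongr
          have h2 : c ^ 2 * (N * (N - 1) + √2 * N) = c * N * (c * (N - 1 + √2)) := by ring
          rw [h2, hcd] at h1
          linarith
      _ = ∑ α ∈ S, projNormSq A α * (2 * c - c ^ 2 * (α + √2)) := by
          rw [← htotal, Finset.mul_sum, Finset.mul_sum, ← Finset.sum_add_distrib, Finset.mul_sum,
            ← Finset.sum_sub_distrib]
          exact Finset.sum_congr rfl fun _ _ => by ring
      _ ≤ _ := by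
          refine Finset.sum_le_sum fun α hα => ?_
          have ht : 0 < α + √2 := by linarith [hlb α hα]
          rw [show α + 2 + (-2 + √2) = α + √2 by ring, div_eq_mul_inv]
          refine mul_le_mul_of_nonneg_left ?_ (projNormSq_pos hS hα).le
          rw [← one_div, le_div_iff₀ ht]
          nlinarith [sq_nonneg (1 - c * (α + √2))]
  have hω : omegaFun A (-2 + √2) ≤ 2 - √2 := by
    rw [omegaFun_eq hS hlb2]
    have h1 := mul_le_mul_of_nonpos_left hw (by linarith : -2 + √2 ≤ 0)
    have h2 : (-2 + √2) * (1 / √2) = 1 - √2 := by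
      field_simp
      linarith
    linarith
  nlinarith

lemma dotProduct_add_smul_one_mulVec_nonneg {ι : Type*} [Fintype ι] [DecidableEq ι]
    {A : Matrix ι ι ℝ} (hA : A.IsHermitian) {c : ℝ} (hc : ∀ β ∈ evSet A, -c ≤ β) (h : ι → ℝ) :
    0 ≤ h ⬝ᵥ (A + c • (1 : Matrix ι ι ℝ)).mulVec h := by
  have hM : (A + c • (1 : Matrix ι ι ℝ)).IsHermitian :=
    hA.add (by simp [Matrix.IsHermitian])
  have hpsd : (A + c • (1 : Matrix ι ι ℝ)).PosSemidef := by
    rw [hM.posSemidef_iff_eigenvalues_nonneg]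
    intro i
    have h1 := hM.mulVec_eigenvectorBasis i
    have h2 := hc (hM.eigenvalues i - c) ⟨(hM.eigenvectorBasis i).ofLp, ?_, ?_⟩
    · simpa using h2
    · intro h0
      exact hM.eigenvectorBasis.toBasis.ne_zero i (by
        ext x
        simpa using congrFun h0 x)
    · rw [Matrix.add_mulVec, Matrix.smul_mulVec, Matrix.one_mulVec] at h1
      rw [sub_smul, ← h1, add_sub_cancel_right]
  simpa using hpsd.dotProduct_mulVec_nonneg h

/-- Minimization of `l (s - ⟨1, h⟩)² + ⟨h, B h⟩` over `h`. -/
lemma fibre_quadratic_lower_bound {ι : Type*} [Fintype ι] {B : Matrix ι ι ℝ} (hB : B.IsSymm)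
    (hnonneg : ∀ h : ι → ℝ, 0 ≤ h ⬝ᵥ B.mulVec h) {v : ι → ℝ} (hv : B.mulVec v = 1) {l : ℝ}
    (hw : 0 < ∑ x, v x) (hω : 0 < 1 + l * ∑ x, v x) (s : ℝ) (h : ι → ℝ) :
    l * s ^ 2 / (1 + l * ∑ x, v x) ≤ l * (s - ∑ x, h x) ^ 2 + h ⬝ᵥ B.mulVec h := by
  set w := ∑ x, v x
  set t := ∑ x, h x with ht
  have hcauchy : t ^ 2 / w ≤ h ⬝ᵥ B.mulVec h := by
    have h1 := hnonneg (h - (t / w) • v)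
    have h2 : v ⬝ᵥ B.mulVec h = t := by
      rw [Matrix.dotProduct_mulVec, ← Matrix.mulVec_transpose, hB.eq, hv, one_dotProduct]
    have h3 : h ⬝ᵥ (1 : ι → ℝ) = t := by rw [dotProduct_one]
    have h4 : v ⬝ᵥ (1 : ι → ℝ) = w := by rw [dotProduct_one]
    simp only [Matrix.mulVec_sub, Matrix.mulVec_smul, hv, sub_dotProduct, dotProduct_sub,
      smul_dotProduct, dotProduct_smul, h2, h3, h4, smul_eq_mul] at h1
    have h5 : t / w * w = t := div_mul_cancel₀ t hw.ne'
    rw [h5] at h1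
    have h6 : t ^ 2 / w = t / w * t := by ring
    linarith
  have hid : l * (s - t) ^ 2 + t ^ 2 / w - l * s ^ 2 / (1 + l * w) =
      (1 + l * w) / w * (t - l * w * s / (1 + l * w)) ^ 2 := by
    field_simp
    ring
  have : 0 ≤ (1 + l * w) / w * (t - l * w * s / (1 + l * w)) ^ 2 := by positivity
  linarith

/-- Main formula when `min ev(A_H) > −√2`. -/
theorem qec_corona_formula_of_minEv_gt_sqrt2 {V₁ V₂ : Type*} [Fintype V₁] [Fintype V₂]
    [DecidableEq V₂]
    (G : SimpleGraph V₁) (H : SimpleGraph V₂) [DecidableRel H.Adj]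
    (hG : G.Connected) (hV₁ : 2 ≤ Fintype.card V₁) (hV₂ : 1 ≤ Fintype.card V₂)
    (hev : -2 - psiStarInv (H.adjMatrix ℝ) (QEC G) ∉ evSet (H.adjMatrix ℝ))
    (hmin : ∀ β ∈ evSet (H.adjMatrix ℝ), -Real.sqrt 2 < β) :
    QEC (corona G H) = psiStarInv (H.adjMatrix ℝ) (QEC G) := by


  set A := H.adjMatrix ℝ with hAdef
  have hA : A.IsHermitian := by simp [A, Matrix.IsHermitian]
  obtain ⟨S, u, hS, hu, hsum, hone⟩ := exists_main_decomposition hA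
  have hne : S.Nonempty := by
    obtain ⟨x⟩ : Nonempty V₂ := Fintype.card_pos_iff.1 hV₂
    by_contra h
    rw [Finset.not_nonempty_iff_eq_empty.1 h] at hone
    simpa using congrFun hone x
  have hlb : ∀ α ∈ S, -√2 < α := by
    intro α hα
    refine hmin α ⟨u α, fun h0 => ?_, hu α⟩
    have := projNormSq_pos hS hα
    rw [← hsum, h0] at this
    simp at this
  have hsq2 : √2 < 2 := (Real.sqrt_lt' two_pos).2 (by norm_num)
  have hlb2 : ∀ α ∈ S, -2 < α := fun α hα => by linarith [hlb α hα]
  have hq := neg_one_le_qec hG hV₁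
  have hm := neg_two_add_sqrt_two_le_psiStarInv H hV₂ hS hne hu hsum hone hlb hq
  obtain ⟨hωpos, hleq, -⟩ := psiStarInv_spec hS hne hlb2 (QEC G)
  rw [← hAdef] at hm
  set l := psiStarInv A (QEC G)
  rw [omegaFun_eq hS hlb2] at hωpos hleq
  have hpole : ∀ α ∈ S, 0 < α + 2 + l := fun α hα => by linarith [hlb α hα]
  let B : Matrix V₂ V₂ ℝ := A + (2 + l) • 1
  have hBsymm : B.IsSymm := by
    simp [B, A, Matrix.IsSymm]
  have hBnonneg : ∀ h : V₂ → ℝ, 0 ≤ h ⬝ᵥ B.mulVec h :=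
    dotProduct_add_smul_one_mulVec_nonneg hA fun β hβ => by linarith [hmin β hβ]
  let v : V₂ → ℝ := ∑ α ∈ S, (α + 2 + l)⁻¹ • u α
  have hv : B.mulVec v = 1 := by
    rw [← hone, Matrix.mulVec_sum]
    refine Finset.sum_congr rfl fun α hα => ?_
    rw [Matrix.mulVec_smul, Matrix.add_mulVec, hu, Matrix.smul_mulVec, Matrix.one_mulVec,
      ← add_smul, smul_smul, ← add_assoc, inv_mul_cancel₀ (hpole α hα).ne', one_smul]
  have hw : ∑ α ∈ S, projNormSq A α / (α + 2 + l) = ∑ x, v x := by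
    simp only [v, Finset.sum_apply, Pi.smul_apply, smul_eq_mul]
    rw [Finset.sum_comm]
    refine Finset.sum_congr rfl fun α _ => ?_
    rw [← Finset.mul_sum, hsum, div_eq_inv_mul]
  have hwpos : 0 < ∑ x, v x := by
    rw [← hw]
    exact Finset.sum_pos (fun α hα => div_pos (projNormSq_pos hS hα) (hpole α hα)) hne
  rw [hw] at hωpos hleq
  have hform : ∀ h : V₂ → ℝ, h ⬝ᵥ (A + (2 : ℝ) • (1 : Matrix V₂ V₂ ℝ)).mulVec h =
      h ⬝ᵥ B.mulVec h - l * ∑ a, h a ^ 2 := by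
    intro h
    have h1 : B = (A + (2 : ℝ) • (1 : Matrix V₂ V₂ ℝ)) + l • 1 := by
      simp only [B, add_smul, add_assoc]
    rw [h1, Matrix.add_mulVec _ (l • (1 : Matrix V₂ V₂ ℝ)), Matrix.smul_mulVec, Matrix.one_mulVec,
      dotProduct_add, dotProduct_smul, smul_eq_mul]
    have h2 : h ⬝ᵥ h = ∑ a, h a ^ 2 := by simp [dotProduct, sq]
    rw [h2]
    ring
  have hnorm : ∀ f : V₁ × Option V₂ → ℝ, ∑ p, f p ^ 2 =
      ∑ i, (f (i, none) ^ 2 + ∑ a, f (i, some a) ^ 2) := by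
    intro f
    simp [Fintype.sum_prod_type, Fintype.sum_option]
  have hcard : 2 ≤ Fintype.card (V₁ × Option V₂) := by
    rw [Fintype.card_prod, Fintype.card_option]
    nlinarith
  obtain ⟨⟨f, hf1, hf0, hfQ⟩, hmax⟩ := qec_attained (corona G H) hcard
  obtain ⟨⟨s, hs1, hs0, hsQ⟩, hGmax⟩ := qec_attained G hV₁
  have hq' : ∀ r : ℝ, QEC G * r ^ 2 = l * r ^ 2 / (1 + l * ∑ x, v x) := by
    intro r
    rw [eq_div_iff hωpos.ne']
    linear_combination -r ^ 2 * hleq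
  apply le_antisymm
  · rw [← hfQ, sum_dist_corona hG H f hf0]
    have h1 := hGmax (fun i => ∑ x, f (i, x)) (by rw [← Fintype.sum_prod_type, hf0])
    have h2 : ∀ i, QEC G * (∑ x, f (i, x)) ^ 2 ≤
        (fun a => f (i, some a)) ⬝ᵥ (A + (2 : ℝ) • (1 : Matrix V₂ V₂ ℝ)).mulVec
          (fun a => f (i, some a)) + l * (f (i, none) ^ 2 + ∑ a, f (i, some a) ^ 2) := by
      intro i
      have h3 := fibre_quadratic_lower_bound hBsymm hBnonneg hv hwpos hωpos (∑ x, f (i, x))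
        (fun a => f (i, some a))
      rw [hq', hform]
      rw [Fintype.sum_option, add_sub_cancel_right] at h3
      rw [Fintype.sum_option]
      linarith
    have h4 := Finset.sum_le_sum fun i (_ : i ∈ Finset.univ) => h2 i
    rw [← Finset.mul_sum, Finset.sum_add_distrib, ← Finset.mul_sum, ← hnorm, hf1] at h4
    linarith
  · set ω := 1 + l * ∑ x, v x with hωdef
    let g : V₁ × Option V₂ → ℝ := fun p => s p.1 * p.2.elim (1 / ω) fun a => l / ω * v a
    have hfib : ∀ i, ∑ x, g (i, x) = s i := by
      intro i
      simp only [g, Fintype.sum_option, Option.elim_none, Option.elim_some, ← Finset.mul_sum]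
      have : 1 / ω + l / ω * ∑ x, v x = 1 := by
        rw [div_mul_eq_mul_div, ← add_div, ← hωdef, div_self hωpos.ne']
      rw [this, mul_one]
    have hg0 : ∑ p, g p = 0 := by
      rw [Fintype.sum_prod_type]
      simp only [hfib, hs0]
    have hgpos : 0 < ∑ p, g p ^ 2 := by
      rw [hnorm]
      have : ∑ i, (s i * (1 / ω)) ^ 2 ≤ ∑ i, (g (i, none) ^ 2 + ∑ a, g (i, some a) ^ 2) :=
        Finset.sum_le_sum fun i _ => le_add_of_nonneg_right
          (Finset.sum_nonneg fun _ _ => sq_nonneg _)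
      refine lt_of_lt_of_le ?_ this
      simp only [mul_pow, ← Finset.sum_mul, hs1]
      positivity
    have h1 := hmax g hg0
    rw [sum_dist_corona hG H g hg0] at h1
    simp only [hfib] at h1
    have h2 : ∀ i, (fun a => g (i, some a)) ⬝ᵥ (A + (2 : ℝ) • (1 : Matrix V₂ V₂ ℝ)).mulVec
        (fun a => g (i, some a)) =
          QEC G * s i ^ 2 - l * (g (i, none) ^ 2 + ∑ a, g (i, some a) ^ 2) := by
      intro i
      have h3 : (fun a => g (i, some a)) = (s i * (l / ω)) • v := by
        ext a
        simp [g, mul_assoc]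
      rw [hform, hq', h3, Matrix.mulVec_smul, hv, smul_dotProduct, dotProduct_smul,
        dotProduct_one]
      simp only [smul_eq_mul, g, Option.elim_none]
      have h4 : l * s i ^ 2 / ω = l * s i ^ 2 * (1 + l * ∑ x, v x) / ω ^ 2 := by
        rw [← hωdef]
        field_simp
      rw [h4]
      ring_nf
    simp only [← hAdef, h2] at h1
    rw [Finset.sum_sub_distrib, ← Finset.mul_sum, ← Finset.mul_sum, ← hnorm, hs1, hsQ] at h1
    have h6 : l * ∑ p, g p ^ 2 ≤ QEC (corona G H) * ∑ p, g p ^ 2 := by linarith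
    exact le_of_mul_le_mul_right h6 hgpos

end QECPaper
end

section
/- Let H be a κ-regular graph on n vertices (n ≥ 1, κ ≥ 0) with adjacency matrix A_H. Then QEC(K₁+H) ≥ 0 if and only if min ev(A_H) ≤ −2, and QEC(K₁+H) ≤ 0 if and only if min ev(A_H) ≥ −2. -/
open scoped BigOperators
open Filter Topology
open scoped Classical

namespace QECPaper

/-- A real symmetric matrix has an eigenvalue bounding its quadratic form from below. -/
theorem exists_mem_evSet_forall_mul_le {ι : Type*} [Fintype ι] [DecidableEq ι] [Nonempty ι]
    {A : Matrix ι ι ℝ} (hA : A.IsHermitian) :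
    ∃ m ∈ evSet A, ∀ g : ι → ℝ, m * ∑ x, g x ^ 2 ≤ g ⬝ᵥ A.mulVec g := by
  obtain ⟨i, hi⟩ := Finite.exists_min hA.eigenvalues
  refine ⟨hA.eigenvalues i, ⟨hA.eigenvectorBasis i, ?_, hA.mulVec_eigenvectorBasis i⟩,
    fun g => ?_⟩
  · intro h
    exact hA.eigenvectorBasis.orthonormal.ne_zero i (by ext x; exact congrFun h x)
  · have hpsd : (A - algebraMap ℝ (Matrix ι ι ℝ) (hA.eigenvalues i)).PosSemidef := by
      refine Matrix.posSemidef_iff_isHermitian_and_spectrum_nonneg.2 ⟨?_, ?_⟩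
      · refine hA.sub ?_
        rw [Matrix.algebraMap_eq_diagonal]
        exact Matrix.isHermitian_diagonal _
      · rw [← spectrum.sub_singleton_eq, hA.spectrum_real_eq_range_eigenvalues]
        rintro _ ⟨_, ⟨j, rfl⟩, _, rfl, rfl⟩
        exact sub_nonneg.2 (hi j)
    have h := hpsd.dotProduct_mulVec_nonneg g
    have hg : g ⬝ᵥ g = ∑ x, g x ^ 2 := by simp [dotProduct, sq]
    rw [Algebra.algebraMap_eq_smul_one, Matrix.sub_mulVec, Matrix.smul_mulVec, Matrix.one_mulVec,
      star_trivial, dotProduct_sub, dotProduct_smul, hg, smul_eq_mul] at h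
    linarith

theorem cone_adj_none_some {V : Type*} (H : SimpleGraph V) (x : V) :
    (cone H).Adj none (some x) := by
  simp [cone]

theorem cone_adj_some_some {V : Type*} (H : SimpleGraph V) (x y : V) :
    (cone H).Adj (some x) (some y) ↔ H.Adj x y := by
  simp [cone]

theorem cone_dist_none_some {V : Type*} (H : SimpleGraph V) (x : V) :
    (cone H).dist none (some x) = 1 :=
  SimpleGraph.dist_eq_one_iff_adj.2 (cone_adj_none_some H x)

theorem cone_dist_some_some {V : Type*} [DecidableEq V] (H : SimpleGraph V) [DecidableRel H.Adj]
    (x y : V) :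
    ((cone H).dist (some x) (some y) : ℝ) =
      2 - 2 * (1 : Matrix V V ℝ) x y - H.adjMatrix ℝ x y := by
  by_cases hxy : x = y
  · subst hxy
    simp
  by_cases hadj : H.Adj x y
  · rw [SimpleGraph.dist_eq_one_iff_adj.2 ((cone_adj_some_some H x y).2 hadj)]
    norm_num [hxy, hadj]
  · have hle := SimpleGraph.dist_le
      (.cons (cone_adj_none_some H x).symm (.cons (cone_adj_none_some H y) .nil))
    have hlt := SimpleGraph.Reachable.one_lt_dist_of_ne_of_not_adj
      ((cone_adj_none_some H x).symm.reachable.trans (cone_adj_none_some H y).reachable)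
      (by simpa using hxy) (mt (cone_adj_some_some H x y).1 hadj)
    have h : (cone H).dist (some x) (some y) = 2 := le_antisymm hle hlt
    simp [h, hxy, hadj]

/-- On zero-sum functions, the distance form of the cone over `H` is minus the form of
`A_H + 2` on the base. -/
theorem cone_dist_form {V : Type*} [Fintype V] [DecidableEq V] (H : SimpleGraph V)
    [DecidableRel H.Adj] {f : Option V → ℝ} {g : V → ℝ} (hg : ∀ x, f (some x) = g x)
    (hf : ∑ x, f x = 0) :
    ∑ x, ∑ y, f x * ((cone H).dist x y : ℝ) * f y =
      -(2 * ∑ x, g x ^ 2 + g ⬝ᵥ (H.adjMatrix ℝ).mulVec g) := by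
  have hnone : f none = -∑ x, g x := by
    simp only [Fintype.sum_option, hg] at hf
    linarith
  have hbase : ∑ x, ∑ y, g x * ((cone H).dist (some x) (some y) : ℝ) * g y =
      2 * ((∑ x, g x) * ∑ x, g x) - 2 * ∑ x, g x ^ 2 - g ⬝ᵥ (H.adjMatrix ℝ).mulVec g := by
    have hone : ∑ x, g x ^ 2 = g ⬝ᵥ (1 : Matrix V V ℝ).mulVec g := by
      simp [dotProduct, sq]
    rw [hone, Finset.sum_mul_sum]
    simp only [dotProduct, Matrix.mulVec, cone_dist_some_some, Finset.mul_sum,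
      ← Finset.sum_sub_distrib]
    exact Finset.sum_congr rfl fun x _ => Finset.sum_congr rfl fun y _ => by ring
  simp only [Fintype.sum_option, hg, SimpleGraph.dist_self, cone_dist_none_some,
    SimpleGraph.dist_comm (v := none), Finset.sum_add_distrib, hbase, hnone, Nat.cast_zero,
    Nat.cast_one, mul_one, mul_zero, zero_add, ← Finset.mul_sum, ← Finset.sum_mul]
  ring

/-- The values whose supremum is `QEC (cone H)`, in terms of functions on the base. -/
theorem mem_cone_dist_form_values_iff {V : Type*} [Fintype V] [DecidableEq V] (H : SimpleGraph V)
    [DecidableRel H.Adj] (r : ℝ) :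
    (∃ f : Option V → ℝ, (∑ x, f x ^ 2) = 1 ∧ (∑ x, f x) = 0 ∧
      r = ∑ x, ∑ y, f x * ((cone H).dist x y : ℝ) * f y) ↔
    ∃ g : V → ℝ, (∑ x, g x) ^ 2 + ∑ x, g x ^ 2 = 1 ∧
      r = -(2 * ∑ x, g x ^ 2 + g ⬝ᵥ (H.adjMatrix ℝ).mulVec g) := by
  constructor
  · rintro ⟨f, hsq, hsum, rfl⟩
    refine ⟨fun x => f (some x), ?_, cone_dist_form H (fun _ => rfl) hsum⟩
    rw [Fintype.sum_option] at hsq hsum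
    rw [← hsq, eq_neg_of_add_eq_zero_left hsum, neg_sq]
  · rintro ⟨g, hsq, rfl⟩
    have hsum : ∑ x : Option V, x.elim (-∑ y, g y) g = 0 := by simp [Fintype.sum_option]
    exact ⟨fun x => x.elim (-∑ y, g y) g, by simpa [Fintype.sum_option] using hsq, hsum,
      (cone_dist_form H (fun _ => rfl) hsum).symm⟩

/-- The least adjacency eigenvalue `m` of `H` controls `QEC (cone H)` from both sides by
positive multiples of `-(m + 2)`. -/
theorem exists_isLeast_evSet_QEC_cone_bounds {V : Type*} [Fintype V] [DecidableEq V] [Nonempty V]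
    (H : SimpleGraph V) [DecidableRel H.Adj] :
    ∃ m, IsLeast (evSet (H.adjMatrix ℝ)) m ∧
      (∃ c > 0, -(m + 2) * c ≤ QEC (cone H)) ∧ ∃ C > 0, QEC (cone H) ≤ -(m + 2) * C := by
  obtain ⟨m, hm, hle⟩ := exists_mem_evSet_forall_mul_le (H.isHermitian_adjMatrix ℝ)
  have hpos : ∀ v : V → ℝ, v ≠ 0 → 0 < ∑ x, v x ^ 2 := fun v hv => by
    obtain ⟨x, hx⟩ := Function.ne_iff.1 hv
    exact Finset.sum_pos' (fun _ _ => sq_nonneg _) ⟨x, Finset.mem_univ x, sq_pos_of_ne_zero hx⟩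
  have hform : ∀ (β : ℝ) (v : V → ℝ), (H.adjMatrix ℝ).mulVec v = β • v →
      v ⬝ᵥ (H.adjMatrix ℝ).mulVec v = β * ∑ x, v x ^ 2 := fun β v hv => by
    rw [hv, dotProduct_smul, smul_eq_mul]
    simp [dotProduct, sq]
  set S : Set ℝ := {r : ℝ | ∃ g : V → ℝ, (∑ x, g x) ^ 2 + ∑ x, g x ^ 2 = 1 ∧
      r = -(2 * ∑ x, g x ^ 2 + g ⬝ᵥ (H.adjMatrix ℝ).mulVec g)}
  have hQEC : QEC (cone H) = sSup S :=
    congrArg sSup (Set.ext (mem_cone_dist_form_values_iff H))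
  obtain ⟨C, hC, hub⟩ : ∃ C > 0, ∀ r ∈ S, r ≤ -(m + 2) * C := by
    rcases le_total 0 (m + 2) with h | h
    · refine ⟨1 / (Fintype.card V + 1), by positivity, ?_⟩
      rintro _ ⟨g, hg, rfl⟩
      have hcs : (∑ x, g x) ^ 2 ≤ Fintype.card V * ∑ x, g x ^ 2 := sq_sum_le_card_mul_sum_sq
      have hnorm : 1 / (Fintype.card V + 1 : ℝ) ≤ ∑ x, g x ^ 2 := by
        rw [div_le_iff₀ (by positivity)]
        linarith
      linarith [hle g, mul_le_mul_of_nonneg_left hnorm h]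
    · refine ⟨1, one_pos, ?_⟩
      rintro _ ⟨g, hg, rfl⟩
      have hnorm : ∑ x, g x ^ 2 ≤ 1 := by linarith [sq_nonneg (∑ x, g x)]
      linarith [hle g, mul_le_mul_of_nonpos_left hnorm h]
  obtain ⟨c, hc, hmem⟩ : ∃ c > 0, -(m + 2) * c ∈ S := by
    obtain ⟨v, hv, hvm⟩ := hm
    have hv2 := hpos v hv
    have ht : 0 < (∑ x, v x) ^ 2 + ∑ x, v x ^ 2 := by positivity
    set s := (√((∑ x, v x) ^ 2 + ∑ x, v x ^ 2))⁻¹ with hs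
    have hs2 : s ^ 2 * ((∑ x, v x) ^ 2 + ∑ x, v x ^ 2) = 1 := by
      rw [hs, inv_pow, Real.sq_sqrt ht.le, inv_mul_cancel₀ ht.ne']
    have hsum : ∑ x, (s • v) x ^ 2 = s ^ 2 * ∑ x, v x ^ 2 := by
      simp [mul_pow, Finset.mul_sum]
    refine ⟨s ^ 2 * ∑ x, v x ^ 2, by positivity, s • v, ?_, ?_⟩
    · rw [hsum, ← hs2]
      simp only [Pi.smul_apply, smul_eq_mul, ← Finset.mul_sum]
      ring
    · rw [hform m (s • v) (by rw [Matrix.mulVec_smul, hvm, smul_comm]), hsum]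
      ring
  refine ⟨m, ⟨hm, ?_⟩, ⟨c, hc, ?_⟩, C, hC, ?_⟩
  · rintro β ⟨v, hv, hvβ⟩
    exact le_of_mul_le_mul_right ((hle v).trans_eq (hform β v hvβ)) (hpos v hv)
  · rw [hQEC]
    exact le_csSup ⟨_, hub⟩ hmem
  · rw [hQEC]
    exact csSup_le ⟨_, hmem⟩ hub

/-- For a `κ`-regular graph `H`, `QEC(K₁+H) ≥ 0` iff
`min ev(A_H) ≤ −2`, and `QEC(K₁+H) ≤ 0` iff `min ev(A_H) ≥ −2`. -/
theorem qec_cone_regular_sign {V₂ : Type*} [Fintype V₂] [DecidableEq V₂]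
    (H : SimpleGraph V₂) [DecidableRel H.Adj] (hV₂ : 1 ≤ Fintype.card V₂)
    (κ : ℕ) (hreg : H.IsRegularOfDegree κ) :
    (0 ≤ QEC (cone H) ↔ ∃ β ∈ evSet (H.adjMatrix ℝ), β ≤ -2) ∧
    (QEC (cone H) ≤ 0 ↔ ∀ β ∈ evSet (H.adjMatrix ℝ), -2 ≤ β) := by
  have : Nonempty V₂ := Fintype.card_pos_iff.1 hV₂
  obtain ⟨m, ⟨hm, hmin⟩, ⟨c, hc, hlower⟩, C, hC, hupper⟩ :=
    exists_isLeast_evSet_QEC_cone_bounds H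
  refine ⟨⟨fun h => ⟨m, hm, ?_⟩, ?_⟩, fun h β hβ => ?_, fun h => ?_⟩
  · have := nonneg_of_mul_nonneg_left (h.trans hupper) hC
    linarith
  · rintro ⟨β, hβ, hβ2⟩
    have := hmin hβ
    exact (mul_nonneg (by linarith) hc.le).trans hlower
  · have := hmin hβ
    have := nonpos_of_mul_nonpos_left (hlower.trans h) hc
    linarith
  · have := h m hm
    exact hupper.trans (mul_nonpos_of_nonpos_of_nonneg (by linarith) hC.le)

end QECPaper
end
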